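/- Let f and Φ be non-trivial functions in OM_+^1 with Φ(0) = 0. Then the following are equivalent: (I) f preserves σ_Φ; (II) there exist α, β ∈ (0,1) such that Φ = f_{!_α} and f = f_{!_β}. -/

import Mathlib

open Matrix Filter Set Topology
open scoped ComplexOrder

noncomputable def matFun {n : ℕ} (f : ℝ → ℝ) (A : Matrix (Fin n) (Fin n) ℂ) :
    Matrix (Fin n) (Fin n) ℂ := cfc f A

def loewnerLE {n : ℕ} (A B : Matrix (Fin n) (Fin n) ℂ) : Prop := (B - A).PosSemidef

def OpMonotone (f : ℝ → ℝ) : Prop :=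
  ∀ (n : ℕ) (A B : Matrix (Fin n) (Fin n) ℂ), A.PosDef → B.PosDef →
    loewnerLE A B → loewnerLE (matFun f A) (matFun f B)

def OMone (f : ℝ → ℝ) : Prop :=
  (∀ t : ℝ, 0 < t → 0 < f t) ∧ f 1 = 1 ∧ OpMonotone f

noncomputable def kuboMean {n : ℕ} (Φ : ℝ → ℝ) (A B : Matrix (Fin n) (Fin n) ℂ) :
    Matrix (Fin n) (Fin n) ℂ :=
  matFun Real.sqrt A *
    matFun Φ (matFun (fun x => (Real.sqrt x)⁻¹) A * B * matFun (fun x => (Real.sqrt x)⁻¹) A) *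
    matFun Real.sqrt A

def Subpreserves (Φ f : ℝ → ℝ) : Prop :=
  ∀ (n : ℕ) (A B : Matrix (Fin n) (Fin n) ℂ), A.PosDef → B.PosDef →
    loewnerLE (matFun f (kuboMean Φ A B)) (kuboMean Φ (matFun f A) (matFun f B))

def PreservesMean (Φ f : ℝ → ℝ) : Prop :=
  ∀ (n : ℕ) (A B : Matrix (Fin n) (Fin n) ℂ), A.PosDef → B.PosDef →
    matFun f (kuboMean Φ A B) = kuboMean Φ (matFun f A) (matFun f B)

def OMTrivial (f : ℝ → ℝ) : Prop :=
  (∀ t : ℝ, 0 < t → f t = 1) ∨ (∀ t : ℝ, 0 < t → f t = t)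

noncomputable def adjFun (f : ℝ → ℝ) : ℝ → ℝ := fun t => (f t⁻¹)⁻¹

noncomputable def transFun (f : ℝ → ℝ) : ℝ → ℝ := fun t => t * f t⁻¹


noncomputable def harmRep (a : ℝ) : ℝ → ℝ := fun t => ((1 - a) + a * t⁻¹)⁻¹

theorem spectrum_pos_of_posDef {n : ℕ} {A : Matrix (Fin n) (Fin n) ℂ} (hA : A.PosDef) {x : ℝ}
    (hx : x ∈ spectrum ℝ A) : 0 < x := by
  rw [hA.1.spectrum_real_eq_range_eigenvalues] at hx
  obtain ⟨i, rfl⟩ := hx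
  exact hA.eigenvalues_pos i

theorem posDef_of_spectrum_pos {n : ℕ} {A : Matrix (Fin n) (Fin n) ℂ} (hA : A.IsHermitian)
    (h : ∀ x ∈ spectrum ℝ A, 0 < x) : A.PosDef := by
  rw [hA.posDef_iff_eigenvalues_pos]
  exact fun i => h _ (hA.eigenvalues_mem_spectrum_real i)

theorem continuousOn_spectrum {n : ℕ} (f : ℝ → ℝ) (A : Matrix (Fin n) (Fin n) ℂ) :
    ContinuousOn f (spectrum ℝ A) :=
  A.finite_real_spectrum.continuousOn f

theorem matFun_congr {n : ℕ} {f g : ℝ → ℝ} (h : ∀ t : ℝ, 0 < t → f t = g t)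
    {A : Matrix (Fin n) (Fin n) ℂ} (hA : A.PosDef) : matFun f A = matFun g A :=
  cfc_congr fun _ hx => h _ (spectrum_pos_of_posDef hA hx)

theorem matFun_isHermitian {n : ℕ} (f : ℝ → ℝ) (A : Matrix (Fin n) (Fin n) ℂ) :
    (matFun f A).IsHermitian :=
  cfc_predicate f A

theorem matFun_posDef {n : ℕ} {f : ℝ → ℝ} (h : ∀ t : ℝ, 0 < t → 0 < f t)
    {A : Matrix (Fin n) (Fin n) ℂ} (hA : A.PosDef) : (matFun f A).PosDef := by
  refine posDef_of_spectrum_pos (matFun_isHermitian f A) fun x hx => ?_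
  rw [matFun, cfc_map_spectrum f A hA.1.isSelfAdjoint (continuousOn_spectrum f A)] at hx
  obtain ⟨y, hy, rfl⟩ := hx
  exact h y (spectrum_pos_of_posDef hA hy)

theorem matFun_proj {n : ℕ} (f : ℝ → ℝ) {P : Matrix (Fin n) (Fin n) ℂ} (hP : P.IsHermitian)
    (hPP : P * P = P) (a b : ℝ) :
    matFun f (a • P + b • (1 - P)) = f a • P + f b • (1 - P) := by
  have hs : IsSelfAdjoint P := hP
  have aff : ∀ a b : ℝ, cfc (fun x : ℝ => b + (a - b) * x) P = a • P + b • (1 - P) := by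
    intro a b
    rw [cfc_const_add b (fun x => (a - b) * x) P (continuousOn_spectrum _ _) hs,
      cfc_const_mul (a - b) (fun x => x) P (continuousOn_spectrum _ _), cfc_id' ℝ P hs,
      Algebra.algebraMap_eq_smul_one]
    module
  have hspec : spectrum ℝ P ⊆ {0, 1} := IsIdempotentElem.spectrum_subset ℝ hPP
  rw [← aff a b, ← aff (f a) (f b), matFun,
    ← cfc_comp' f (fun x : ℝ => b + (a - b) * x) P ((Set.toFinite _).image _ |>.continuousOn _)
      (continuousOn_spectrum _ _) hs]
  refine cfc_congr fun x hx => ?_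
  rcases hspec hx with h | h
  · simp [h]
  · rw [Set.mem_singleton_iff.mp h]; simp

theorem tendsto_matFun {ι : Type*} {l : Filter ι} [l.NeBot] {n : ℕ} {f : ℝ → ℝ} (hf : Continuous f)
    {X : ι → Matrix (Fin n) (Fin n) ℂ} {Y : Matrix (Fin n) (Fin n) ℂ}
    (hX : ∀ᶠ i in l, (X i).IsHermitian) (hXY : Tendsto X l (𝓝 Y)) :
    Tendsto (fun i => matFun f (X i)) l (𝓝 (matFun f Y)) := by
  open scoped Matrix.Norms.L2Operator in
  have hY : Y.IsHermitian := by
    have hc : IsClosed {Z : Matrix (Fin n) (Fin n) ℂ | Z.IsHermitian} :=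
      isClosed_eq (by fun_prop) continuous_id
    exact hc.mem_of_tendsto hXY hX
  have hb : ∀ᶠ i in l, ‖X i‖ ≤ ‖Y‖ + 1 :=
    (hXY.norm.eventually (gt_mem_nhds (lt_add_one ‖Y‖))).mono fun _ h => h.le
  have hsub : ∀ Z : Matrix (Fin n) (Fin n) ℂ, ‖Z‖ ≤ ‖Y‖ + 1 →
      spectrum ℝ Z ⊆ Metric.closedBall 0 (‖Y‖ + 1) := fun Z hZ x hx => by
    rcases isEmpty_or_nonempty (Fin n) with h | h
    · have : Subsingleton (Matrix (Fin n) (Fin n) ℂ) := inferInstance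
      simp [spectrum.of_subsingleton] at hx
    · have := spectrum.norm_le_norm_of_mem hx
      simpa using this.trans hZ
  exact hXY.cfc (isCompact_closedBall 0 (‖Y‖ + 1)) f (hb.mono fun i h => hsub _ h) hX
    (hsub _ (by linarith)) hY hf.continuousOn

/-- The real matrix with entries `p ^ 2`, `p * q`, `q ^ 2`, a projection when
`p ^ 2 + q ^ 2 = 1`. -/
noncomputable def rankOne (p q : ℝ) : Matrix (Fin 2) (Fin 2) ℂ :=
  !![(p ^ 2 : ℝ), (p * q : ℝ); (p * q : ℝ), (q ^ 2 : ℝ)]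

/-- The real diagonal matrix with entries `a`, `b`. -/
noncomputable def realDiag (a b : ℝ) : Matrix (Fin 2) (Fin 2) ℂ := !![(a : ℂ), 0; 0, (b : ℂ)]

theorem rankOne_eq_vecMulVec (p q : ℝ) :
    rankOne p q = vecMulVec ![(p : ℂ), (q : ℂ)] (star ![(p : ℂ), (q : ℂ)]) := by
  ext i j
  fin_cases i <;> fin_cases j <;> simp [rankOne, vecMulVec_apply] <;> ring

theorem rankOne_posSemidef (p q : ℝ) : (rankOne p q).PosSemidef := by
  rw [rankOne_eq_vecMulVec]
  exact posSemidef_vecMulVec_self_star _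

theorem rankOne_mul_self {p q : ℝ} (h : p ^ 2 + q ^ 2 = 1) :
    rankOne p q * rankOne p q = rankOne p q := by
  have h' : (p : ℂ) ^ 2 + (q : ℂ) ^ 2 = 1 := by exact_mod_cast h
  ext i j
  fin_cases i <;> fin_cases j <;> simp [rankOne, Matrix.mul_apply, Fin.sum_univ_two]
  · linear_combination (p : ℂ) ^ 2 * h'
  · linear_combination (p : ℂ) * q * h'
  · linear_combination (p : ℂ) * q * h'
  · linear_combination (q : ℂ) ^ 2 * h'

theorem realDiag_eq (a b : ℝ) :
    realDiag a b = a • rankOne 1 0 + b • (1 - rankOne 1 0) := by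
  ext i j
  fin_cases i <;> fin_cases j <;> simp [rankOne, realDiag]

theorem matFun_realDiag (f : ℝ → ℝ) (a b : ℝ) :
    matFun f (realDiag a b) = realDiag (f a) (f b) := by
  rw [realDiag_eq, realDiag_eq,
    matFun_proj f (rankOne_posSemidef 1 0).1 (rankOne_mul_self (by norm_num))]

theorem realDiag_posDef {a b : ℝ} (ha : 0 < a) (hb : 0 < b) : (realDiag a b).PosDef := by
  have : realDiag a b = Matrix.diagonal ![(a : ℂ), (b : ℂ)] := by
    ext i j
    fin_cases i <;> fin_cases j <;> simp [realDiag]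
  rw [this]
  refine PosDef.diagonal fun i => ?_
  fin_cases i <;> simpa

theorem OpMonotone.two_point {f : ℝ → ℝ} (hf : OpMonotone f) {c p q d₁ d₂ r : ℝ} (hc : 0 < c)
    (hpq : p ^ 2 + q ^ 2 = 1) (h₁ : 0 < d₁) (h₂ : 0 < d₂) (hr : 0 < r)
    (h : r * (p ^ 2 * d₂ + q ^ 2 * d₁) = d₁ * d₂) (y z : ℝ) :
    (f (c + r) - f c) * (p * y + q * z) ^ 2 ≤
      (f (c + d₁) - f c) * y ^ 2 + (f (c + d₂) - f c) * z ^ 2 := by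
  have hC : ((c + r) • rankOne p q + c • (1 - rankOne p q)).PosDef := by
    have : (c + r) • rankOne p q + c • (1 - rankOne p q)
        = c • (1 : Matrix (Fin 2) (Fin 2) ℂ) + r • rankOne p q := by module
    rw [this]
    exact (PosDef.one.smul hc).add_posSemidef ((rankOne_posSemidef p q).smul hr.le)
  have hle : loewnerLE ((c + r) • rankOne p q + c • (1 - rankOne p q))
      (realDiag (c + d₁) (c + d₂)) := by
    have e : realDiag (c + d₁) (c + d₂) - ((c + r) • rankOne p q + c • (1 - rankOne p q))
        = rankOne (q * √(r * d₁ / d₂)) (-(p * √(r * d₂ / d₁))) := by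
      have s₁ : √(r * d₁ / d₂) ^ 2 = r * d₁ / d₂ := Real.sq_sqrt (by positivity)
      have s₂ : √(r * d₂ / d₁) ^ 2 = r * d₂ / d₁ := Real.sq_sqrt (by positivity)
      have s₃ : √(r * d₁ / d₂) * √(r * d₂ / d₁) = r := by
        rw [← Real.sqrt_mul (by positivity),
          show r * d₁ / d₂ * (r * d₂ / d₁) = r ^ 2 by field_simp, Real.sqrt_sq hr.le]
      have e₁ : d₁ - r * p ^ 2 = (q * √(r * d₁ / d₂)) ^ 2 := by
        rw [mul_pow, s₁]; field_simp; linear_combination -h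
      have e₂ : d₂ - r * q ^ 2 = (-(p * √(r * d₂ / d₁))) ^ 2 := by
        rw [neg_sq, mul_pow, s₂]; field_simp; linear_combination -h
      have e₃ : -(r * (p * q)) = q * √(r * d₁ / d₂) * -(p * √(r * d₂ / d₁)) := by
        linear_combination (-(p * q)) * -s₃
      have e₄ : rankOne (q * √(r * d₁ / d₂)) (-(p * √(r * d₂ / d₁))) =
          (!![((d₁ - r * p ^ 2 : ℝ) : ℂ), ((-(r * (p * q)) : ℝ) : ℂ);
            ((-(r * (p * q)) : ℝ) : ℂ), ((d₂ - r * q ^ 2 : ℝ) : ℂ)]) := by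
        rw [rankOne, e₁, e₂, e₃]
      rw [e₄]
      ext i j
      fin_cases i <;> fin_cases j <;> simp [rankOne, realDiag] <;> ring
    rw [loewnerLE, e]
    exact rankOne_posSemidef _ _
  have key := hf 2 _ _ hC (realDiag_posDef (by linarith) (by linarith)) hle
  rw [matFun_realDiag, matFun_proj f (rankOne_posSemidef p q).1 (rankOne_mul_self hpq),
    loewnerLE] at key
  have := key.dotProduct_mulVec_nonneg ![(y : ℂ), (z : ℂ)]
  rw [show star ![(y : ℂ), (z : ℂ)] ⬝ᵥ (realDiag (f (c + d₁)) (f (c + d₂)) -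
      (f (c + r) • rankOne p q + f c • (1 - rankOne p q))) *ᵥ ![(y : ℂ), (z : ℂ)] =
      (((f (c + d₁) - f c) * y ^ 2 + (f (c + d₂) - f c) * z ^ 2 -
        (f (c + r) - f c) * (p * y + q * z) ^ 2 : ℝ) : ℂ) by
    simp [dotProduct, mulVec, Fin.sum_univ_two, rankOne, realDiag]
    ring] at this
  have := Complex.zero_le_real.mp this
  linarith

theorem OpMonotone.monotoneOn {f : ℝ → ℝ} (hf : OpMonotone f) : MonotoneOn f (Ioi 0) := by
  intro a ha b hb hab
  have hle : loewnerLE (realDiag a a) (realDiag b b) := by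
    have e : realDiag b b - realDiag a a = (b - a) • (1 : Matrix (Fin 2) (Fin 2) ℂ) := by
      ext i j
      fin_cases i <;> fin_cases j <;> simp [realDiag]
    rw [loewnerLE, e]
    exact PosSemidef.one.smul (sub_nonneg.mpr hab)
  have key := hf 2 _ _ (realDiag_posDef ha ha) (realDiag_posDef hb hb) hle
  rw [matFun_realDiag, matFun_realDiag, loewnerLE] at key
  have h0 := key.diag_nonneg (i := 0)
  rw [show (realDiag (f b) (f b) - realDiag (f a) (f a)) 0 0 = ((f b - f a : ℝ) : ℂ) by
    simp [realDiag]] at h0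
  exact sub_nonneg.mp (Complex.zero_le_real.mp h0)

theorem OpMonotone.concaveOn {f : ℝ → ℝ} (hf : OpMonotone f) : ConcaveOn ℝ (Ioi 0) f := by
  refine concaveOn_of_slope_anti_adjacent (convex_Ioi 0) fun {a b d} ha _ hab hbd => ?_
  have ha : 0 < a := ha
  have hr : 0 < b - a := by linarith
  have hr' : 0 < d - a := by linarith
  have key : (b - a) / (d - a) * (f d - f a) ≤ f b - f a := by
    have ht : Tendsto (fun s : ℝ => s * (f d - f a)) (𝓝[<] ((b - a) / (d - a)))
        (𝓝 ((b - a) / (d - a) * (f d - f a))) :=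
      (Continuous.tendsto (by fun_prop) _).mono_left nhdsWithin_le_nhds
    refine le_of_tendsto ht ?_
    filter_upwards [Ioo_mem_nhdsLT (show 0 < (b - a) / (d - a) by positivity)] with s hs
    have hs1 : s < 1 := hs.2.trans ((div_lt_one hr').mpr (by linarith))
    have hs2 : 0 < (b - a) - s * (d - a) := by
      have := (lt_div_iff₀ hr').mp hs.2
      linarith
    have h2 := hf.two_point (c := a) (p := √s) (q := √(1 - s)) (d₁ := b - a)
      (d₂ := (1 - s) * (d - a) * (b - a) / ((b - a) - s * (d - a))) (r := d - a) ha
      (by rw [Real.sq_sqrt hs.1.le, Real.sq_sqrt (by linarith)]; ring) hr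
      (by have : 0 < 1 - s := by linarith
          positivity) hr'
      (by rw [Real.sq_sqrt hs.1.le, Real.sq_sqrt (by linarith)]
          generalize hD : b - a - s * (d - a) = D at hs2 ⊢
          field_simp
          rw [← hD]
          ring) 1 0
    simp only [mul_one, mul_zero, add_zero, one_pow, Real.sq_sqrt hs.1.le] at h2
    rw [add_sub_cancel, add_sub_cancel] at h2
    norm_num at h2
    linarith
  rw [div_mul_eq_mul_div, div_le_iff₀ hr'] at key
  rw [div_le_div_iff₀ (by linarith) hr]
  linarith

theorem OpMonotone.continuousOn {f : ℝ → ℝ} (hf : OpMonotone f) : ContinuousOn f (Ioi 0) :=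
  hf.concaveOn.continuousOn isOpen_Ioi

theorem ConcaveOn.three_point {w : ℝ → ℝ} (hw : ConcaveOn ℝ (Ioi 0) w) {x y z : ℝ} (hx : 0 < x)
    (hxy : x < y) (hyz : y < z) : (z - y) * w x + (y - x) * w z ≤ (z - x) * w y := by
  have hxz : 0 < z - x := by linarith
  have := hw.2 (show x ∈ Ioi (0 : ℝ) from hx) (show z ∈ Ioi (0 : ℝ) by simp; linarith)
    (show 0 ≤ (z - y) / (z - x) from div_nonneg (by linarith) hxz.le)
    (show 0 ≤ (y - x) / (z - x) from div_nonneg (by linarith) hxz.le) (by field_simp; ring)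
  simp only [smul_eq_mul] at this
  rw [show (z - y) / (z - x) * x + (y - x) / (z - x) * z = y by field_simp; ring,
    div_mul_eq_mul_div, div_mul_eq_mul_div, ← add_div, div_le_iff₀ hxz] at this
  linarith

theorem ConcaveOn.mul_le_mul_of_nonneg {w : ℝ → ℝ} (hw : ConcaveOn ℝ (Ioi 0) w)
    (h0 : ∀ x, 0 < x → 0 ≤ w x) {x y : ℝ} (hx : 0 < x) (hxy : x ≤ y) :
    x * w y ≤ y * w x := by
  rcases hxy.eq_or_lt with rfl | hxy
  · rfl
  have ht : Tendsto (fun e : ℝ => (x - e) * w y) (𝓝[>] 0) (𝓝 ((x - 0) * w y)) :=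
    (Continuous.tendsto (by fun_prop) _).mono_left nhdsWithin_le_nhds
  have ht' : Tendsto (fun e : ℝ => (y - e) * w x) (𝓝[>] 0) (𝓝 ((y - 0) * w x)) :=
    (Continuous.tendsto (by fun_prop) _).mono_left nhdsWithin_le_nhds
  rw [sub_zero] at ht ht'
  refine le_of_tendsto_of_tendsto ht ht' ?_
  filter_upwards [Ioo_mem_nhdsGT hx] with e he
  have h1 := hw.three_point he.1 he.2 hxy
  have : 0 ≤ (y - x) * w e := mul_nonneg (by linarith) (h0 e he.1)
  linarith

theorem adjFun_concaveOn {Φ : ℝ → ℝ} (hΦ : OpMonotone Φ) (hpos : ∀ t, 0 < t → 0 < Φ t)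
    (h0 : Tendsto Φ (𝓝[>] 0) (𝓝 0)) : ConcaveOn ℝ (Ioi 0) (adjFun Φ) := by
  refine ⟨convex_Ioi 0, fun x hx y hy s t hs ht hst => ?_⟩
  have hx : 0 < x := hx
  have hy : 0 < y := hy
  have hsum : 0 < s * x + t * y := by
    rcases hs.eq_or_lt with rfl | hs
    · have : t = 1 := by linarith
      simpa [this] using hy
    · have := mul_nonneg ht hy.le
      positivity
  set r := (s * x + t * y)⁻¹ with hr
  have hr0 : 0 < r := inv_pos.mpr hsum
  have lim : ∀ d : ℝ, 0 < d → Tendsto (fun c => Φ (c + d) - Φ c) (𝓝[>] 0) (𝓝 (Φ d)) := by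
    intro d hd
    have h1 : Tendsto (fun c => Φ (c + d)) (𝓝[>] 0) (𝓝 (Φ d)) := by
      have hc : ContinuousAt Φ d := hΦ.continuousOn.continuousAt (Ioi_mem_nhds hd)
      have : Tendsto (fun c : ℝ => c + d) (𝓝[>] 0) (𝓝 (0 + d)) :=
        (Continuous.tendsto (by fun_prop) _).mono_left nhdsWithin_le_nhds
      rw [zero_add] at this
      exact hc.tendsto.comp this
    simpa using h1.sub h0
  have key : ∀ y' z' : ℝ, Φ r * (√s * y' + √t * z') ^ 2 ≤ Φ x⁻¹ * y' ^ 2 + Φ y⁻¹ * z' ^ 2 := by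
    intro y' z'
    refine le_of_tendsto_of_tendsto ((lim r hr0).mul_const _)
      (((lim _ (inv_pos.mpr hx)).mul_const _).add ((lim _ (inv_pos.mpr hy)).mul_const _)) ?_
    filter_upwards [self_mem_nhdsWithin] with c hc
    refine hΦ.two_point hc (by rw [Real.sq_sqrt hs, Real.sq_sqrt ht, hst]) (inv_pos.mpr hx)
      (inv_pos.mpr hy) hr0 ?_ y' z'
    rw [Real.sq_sqrt hs, Real.sq_sqrt ht, hr]
    field_simp
  have hX := hpos _ (inv_pos.mpr hx)
  have hY := hpos _ (inv_pos.mpr hy)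
  have hR := hpos _ hr0
  have h1 := key (√s * (Φ x⁻¹)⁻¹) (√t * (Φ y⁻¹)⁻¹)
  simp only [mul_pow, ← mul_assoc, Real.mul_self_sqrt hs, Real.mul_self_sqrt ht,
    Real.sq_sqrt hs, Real.sq_sqrt ht] at h1
  simp only [adjFun, smul_eq_mul]
  rw [← hr]
  set T := s * (Φ x⁻¹)⁻¹ + t * (Φ y⁻¹)⁻¹ with hT
  have h2 : Φ x⁻¹ * s * (Φ x⁻¹)⁻¹ ^ 2 + Φ y⁻¹ * t * (Φ y⁻¹)⁻¹ ^ 2 = T := by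
    rw [hT]; field_simp
  rw [h2] at h1
  have hT0 : 0 ≤ T := by positivity
  rcases hT0.eq_or_lt with h | h
  · rw [← h]; positivity
  · rw [le_inv_comm₀ h hR, ← one_div, le_div_iff₀ h]
    have : Φ r * T * T ≤ 1 * T := by linarith
    exact le_of_mul_le_mul_right this h

theorem eq_id_of_ratio_eq {Φ : ℝ → ℝ} (hΦ : ConcaveOn ℝ (Ioi 0) Φ)
    (hadj : ConcaveOn ℝ (Ioi 0) (adjFun Φ)) (hpos : ∀ t, 0 < t → 0 < Φ t) (h1 : Φ 1 = 1)
    {x y : ℝ} (hx : 0 < x) (hxy : x < y) (h : x * adjFun Φ y = y * adjFun Φ x)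
    {t : ℝ} (ht : 0 < t) : Φ t = t := by
  have hy : 0 < y := hx.trans hxy
  have hapos : ∀ t, 0 < t → 0 < adjFun Φ t := fun t ht => inv_pos.mpr (hpos _ (inv_pos.mpr ht))
  have small : ∀ z, 0 < z → z ≤ x → x * adjFun Φ z = z * adjFun Φ x := by
    intro z hz hzx
    refine le_antisymm ?_ (hadj.mul_le_mul_of_nonneg (fun t ht => (hapos t ht).le) hz hzx)
    rcases hzx.eq_or_lt with rfl | hzx
    · rfl
    have h2 := hadj.three_point hz hzx hxy
    have h3 := mul_le_mul_of_nonneg_left h2 hx.le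
    have h4 : 0 < y - x := by linarith
    refine le_of_mul_le_mul_left ?_ h4
    linear_combination h3 - (x - z) * h
  set C := adjFun Φ x / x with hC
  have hC0 : 0 < C := div_pos (hapos x hx) hx
  have large : ∀ u, x⁻¹ ≤ u → C * Φ u = u := by
    intro u hu
    have hu0 : 0 < u := (inv_pos.mpr hx).trans_le hu
    have := small u⁻¹ (inv_pos.mpr hu0) (inv_le_of_inv_le₀ hx hu)
    have hh : adjFun Φ u⁻¹ = (Φ u)⁻¹ := by simp [adjFun]
    rw [hh] at this
    have := hpos u hu0
    rw [hC]
    field_simp at *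
    linarith
  have all : ∀ u, 0 < u → C * Φ u = u := by
    intro u hu
    rcases le_or_gt x⁻¹ u with hux | hux
    · exact large u hux
    set v := x⁻¹ with hv
    have hv0 : 0 < v := inv_pos.mpr hx
    have lv := large v le_rfl
    have lw := large (v + 1) (by linarith)
    have r := hΦ.mul_le_mul_of_nonneg (fun t ht => (hpos t ht).le) hu hux.le
    have h2 := hΦ.three_point hu hux (lt_add_one v)
    have h3 := mul_le_mul_of_nonneg_left h2 hC0.le
    have h4 := mul_le_mul_of_nonneg_left r hC0.le
    refine le_antisymm ?_ ?_
    · linear_combination h3 - (v - u) * lw + (v + 1 - u) * lv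
    · refine le_of_mul_le_mul_left ?_ hv0
      linear_combination h4 - u * lv
  have hC1 : C = 1 := by simpa [h1] using all 1 one_pos
  simpa [hC1] using all t ht

/-- For non-trivial `Φ` with `Φ(0) = 0`, the function `t ↦ Φ t / t` is injective. -/
theorem ratio_injective {Φ : ℝ → ℝ} (hΦ : OMone Φ) (hnt : ¬ OMTrivial Φ)
    (h0 : Tendsto Φ (𝓝[>] 0) (𝓝 0)) {s t : ℝ} (hs : 0 < s) (ht : 0 < t)
    (h : Φ s / s = Φ t / t) : s = t := by
  have aux : ∀ {s t : ℝ}, 0 < s → s < t → Φ s / s = Φ t / t → False := by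
    intro s t hs hst h
    have ht := hs.trans hst
    refine hnt (Or.inr fun u hu => eq_id_of_ratio_eq hΦ.2.2.concaveOn
      (adjFun_concaveOn hΦ.2.2 hΦ.1 h0) hΦ.1 hΦ.2.1 (x := t⁻¹) (y := s⁻¹) (inv_pos.mpr ht)
      (inv_strictAnti₀ hs hst) ?_ hu)
    have := hΦ.1 s hs
    have := hΦ.1 t ht
    simp only [adjFun, inv_inv]
    field_simp at *
    linarith
  rcases lt_trichotomy s t with hst | hst | hst
  · exact (aux hs hst h).elim
  · exact hst
  · exact (aux ht hst h.symm).elim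

theorem realDiag_mul_rankOne_mul (u v p q : ℝ) :
    realDiag u v * rankOne p q * realDiag u v = rankOne (u * p) (v * q) := by
  ext i j
  fin_cases i <;> fin_cases j <;>
    simp [rankOne, realDiag, Matrix.mul_apply, Fin.sum_univ_two] <;> ring

theorem rankOne_mul_mul (k p q : ℝ) : rankOne (k * p) (k * q) = k ^ 2 • rankOne p q := by
  ext i j
  fin_cases i <;> fin_cases j <;> simp [rankOne] <;> ring

theorem smul_rankOne_injective {p q : ℝ} (h : p ^ 2 + q ^ 2 = 1) {c d : ℝ}
    (hcd : c • rankOne p q = d • rankOne p q) : c = d := by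
  have h₀ := congrFun (congrFun hcd 0) 0
  have h₁ := congrFun (congrFun hcd 1) 1
  simp [rankOne] at h₀ h₁
  have h₀' : c * p ^ 2 = d * p ^ 2 := by
    rcases h₀ with h | h
    · rw [h]
    · rw [h]; ring
  have h₁' : c * q ^ 2 = d * q ^ 2 := by
    rcases h₁ with h | h
    · rw [h]
    · rw [h]; ring
  linear_combination h₀' + h₁' - (c - d) * h

theorem kuboMean_realDiag (Φ : ℝ → ℝ) {a : ℝ} (ha : 0 < a) (b : ℝ) :
    kuboMean Φ (realDiag a a) (realDiag b b) = realDiag (a * Φ (b / a)) (a * Φ (b / a)) := by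
  have e : ∀ u v : ℝ, realDiag u u * realDiag v v * realDiag u u
      = realDiag (u * v * u) (u * v * u) := by
    intro u v
    ext i j
    fin_cases i <;> fin_cases j <;> simp [realDiag, Matrix.mul_apply, Fin.sum_univ_two]
  have h1 : √a * √a = a := Real.mul_self_sqrt ha.le
  have h2 : (√a)⁻¹ * b * (√a)⁻¹ = b / a := by
    rw [mul_right_comm, ← mul_inv, h1, inv_mul_eq_div]
  rw [kuboMean, matFun_realDiag, matFun_realDiag, e, matFun_realDiag, e, h2, mul_right_comm, h1]

theorem mul_mul_posDef {n : ℕ} {S X : Matrix (Fin n) (Fin n) ℂ} (hS : S.PosDef) (hX : X.PosDef) :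
    (S * X * S).PosDef := by
  have := (Matrix.IsUnit.posDef_star_right_conjugate_iff hS.isUnit).mpr hX
  rwa [show star S = S from hS.1] at this

theorem kuboMean_posDef {n : ℕ} {Φ : ℝ → ℝ} (h : ∀ t, 0 < t → 0 < Φ t)
    {A B : Matrix (Fin n) (Fin n) ℂ} (hA : A.PosDef) (hB : B.PosDef) :
    (kuboMean Φ A B).PosDef :=
  mul_mul_posDef (matFun_posDef (fun _ ht => Real.sqrt_pos.mpr ht) hA)
    (matFun_posDef h (mul_mul_posDef
      (matFun_posDef (fun _ ht => inv_pos.mpr (Real.sqrt_pos.mpr ht)) hA) hB))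

/-- The extension of `f` by zero to the non-positive reals. -/
noncomputable def extendZero (f : ℝ → ℝ) : ℝ → ℝ := fun x => if 0 < x then f x else 0

theorem extendZero_of_pos (f : ℝ → ℝ) {t : ℝ} (ht : 0 < t) : extendZero f t = f t := if_pos ht

theorem continuous_extendZero {f : ℝ → ℝ} (hf : ContinuousOn f (Ioi 0))
    (h0 : Tendsto f (𝓝[>] 0) (𝓝 0)) : Continuous (extendZero f) := by
  rw [continuous_iff_continuousAt]
  intro x
  rcases lt_trichotomy x 0 with hx | rfl | hx
  · have : extendZero f =ᶠ[𝓝 x] fun _ => 0 := by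
      filter_upwards [gt_mem_nhds hx] with y hy
      exact if_neg hy.not_gt
    exact continuousAt_const.congr this.symm
  · rw [continuousAt_iff_continuous_left'_right']
    have e0 : extendZero f 0 = 0 := if_neg (lt_irrefl 0)
    constructor
    · rw [ContinuousWithinAt, e0]
      refine tendsto_const_nhds.congr' ?_
      filter_upwards [self_mem_nhdsWithin] with y hy
      exact (if_neg (show ¬ 0 < y from (show y < 0 from hy).not_gt)).symm
    · rw [ContinuousWithinAt, e0]
      refine h0.congr' ?_
      filter_upwards [self_mem_nhdsWithin] with y hy
      exact (extendZero_of_pos f hy).symm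
  · have : extendZero f =ᶠ[𝓝 x] f := by
      filter_upwards [lt_mem_nhds hx] with y hy
      exact extendZero_of_pos f hy
    exact (hf.continuousAt (Ioi_mem_nhds hx)).congr this.symm

theorem rankOne_add_smul_posDef {p q d : ℝ} (h : p ^ 2 + q ^ 2 = 1) (hd : 0 < d) :
    (rankOne p q + d • (1 - rankOne p q)).PosDef := by
  rcases le_or_gt d 1 with hd1 | hd1
  · rw [show rankOne p q + d • (1 - rankOne p q) =
      d • (1 : Matrix (Fin 2) (Fin 2) ℂ) + (1 - d) • rankOne p q by module]
    exact (PosDef.one.smul hd).add_posSemidef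
      ((rankOne_posSemidef p q).smul (sub_nonneg.mpr hd1))
  · have hperp : 1 - rankOne p q = rankOne q (-p) := by
      have h' : (p : ℂ) ^ 2 + (q : ℂ) ^ 2 = 1 := by exact_mod_cast h
      ext i j
      fin_cases i <;> fin_cases j <;> simp [rankOne]
      · linear_combination -h'
      · ring
      · ring
      · linear_combination -h'
    rw [show rankOne p q + d • (1 - rankOne p q) =
      (1 : Matrix (Fin 2) (Fin 2) ℂ) + (d - 1) • (1 - rankOne p q) by module, hperp]
    exact PosDef.one.add_posSemidef ((rankOne_posSemidef _ _).smul (sub_nonneg.mpr hd1.le))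

theorem tendsto_kuboMean_rankOne {Φ : ℝ → ℝ} (hΦ : ContinuousOn Φ (Ioi 0))
    (h0 : Tendsto Φ (𝓝[>] 0) (𝓝 0)) {a b p q : ℝ} (ha : 0 < a) (hb : 0 < b)
    (hpq : p ^ 2 + q ^ 2 = 1) :
    Tendsto (fun d : ℝ => kuboMean Φ (realDiag a b) (rankOne p q + d • (1 - rankOne p q)))
      (𝓝[>] 0) (𝓝 ((Φ (p ^ 2 / a + q ^ 2 / b) / (p ^ 2 / a + q ^ 2 / b)) • rankOne p q)) := by
  have hsa := Real.sqrt_pos.mpr ha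
  have hsb := Real.sqrt_pos.mpr hb
  have hs : 0 < p ^ 2 / a + q ^ 2 / b := by
    by_contra! hcon
    have h1 : 0 ≤ p ^ 2 / a := by positivity
    have h2 : 0 ≤ q ^ 2 / b := by positivity
    have h3 : p ^ 2 / a = 0 := by linarith
    have h4 : q ^ 2 / b = 0 := by linarith
    rw [div_eq_zero_iff] at h3 h4
    have := h3.resolve_right ha.ne'
    have := h4.resolve_right hb.ne'
    linarith
  set s := p ^ 2 / a + q ^ 2 / b with hs_def
  have hss := Real.sqrt_pos.mpr hs
  set D := realDiag (√a)⁻¹ (√b)⁻¹ with hD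
  have lim : Tendsto (fun d : ℝ => D * (rankOne p q + d • (1 - rankOne p q)) * D) (𝓝[>] 0)
      (𝓝 (D * (rankOne p q + (0 : ℝ) • (1 - rankOne p q)) * D)) :=
    (Continuous.tendsto (by fun_prop) _).mono_left nhdsWithin_le_nhds
  have hDpd : D.PosDef := realDiag_posDef (inv_pos.mpr hsa) (inv_pos.mpr hsb)
  have pd : ∀ d : ℝ, 0 < d → (D * (rankOne p q + d • (1 - rankOne p q)) * D).PosDef :=
    fun d hd => mul_mul_posDef hDpd (rankOne_add_smul_posDef hpq hd)
  have lim2 := tendsto_matFun (continuous_extendZero hΦ h0)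
    (by filter_upwards [self_mem_nhdsWithin] with d hd using (pd d hd).1) lim
  have hu : (p / (√a * √s)) ^ 2 + (q / (√b * √s)) ^ 2 = 1 := by
    rw [div_pow, div_pow, mul_pow, mul_pow, Real.sq_sqrt ha.le, Real.sq_sqrt hb.le,
      Real.sq_sqrt hs.le, ← div_div, ← div_div, ← add_div, ← hs_def, div_self hs.ne']
  have e1 : D * (rankOne p q + (0 : ℝ) • (1 - rankOne p q)) * D =
      s • rankOne (p / (√a * √s)) (q / (√b * √s)) +
        (0 : ℝ) • (1 - rankOne (p / (√a * √s)) (q / (√b * √s))) := by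
    rw [zero_smul, zero_smul, add_zero, add_zero, hD, realDiag_mul_rankOne_mul]
    conv_rhs => rw [← Real.sq_sqrt hs.le, ← rankOne_mul_mul]
    rw [Real.sq_sqrt hs.le]
    congr 1 <;> field_simp
  rw [e1, matFun_proj _ (rankOne_posSemidef _ _).1 (rankOne_mul_self hu), extendZero_of_pos Φ hs,
    show extendZero Φ 0 = 0 from if_neg (lt_irrefl 0), zero_smul, add_zero] at lim2
  have lim3 := (lim2.const_mul (realDiag √a √b)).mul_const (realDiag √a √b)
  have e2 : realDiag √a √b * Φ s • rankOne (p / (√a * √s)) (q / (√b * √s)) * realDiag √a √b =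
      (Φ s / s) • rankOne p q := by
    rw [Matrix.mul_smul, Matrix.smul_mul, realDiag_mul_rankOne_mul,
      show √a * (p / (√a * √s)) = (√s)⁻¹ * p by field_simp,
      show √b * (q / (√b * √s)) = (√s)⁻¹ * q by field_simp, rankOne_mul_mul, smul_smul,
      inv_pow, Real.sq_sqrt hs.le, div_eq_mul_inv]
  rw [e2] at lim3
  refine lim3.congr' ?_
  filter_upwards [self_mem_nhdsWithin] with d hd
  rw [kuboMean, matFun_realDiag, matFun_realDiag, ← hD,
    matFun_congr (fun t ht => extendZero_of_pos Φ ht) (pd d hd)]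

theorem PreservesMean.rankOne_eq {Φ f : ℝ → ℝ} (h : PreservesMean Φ f) (hf : OMone f)
    (hΦ : OMone Φ) (hΦ0 : Tendsto Φ (𝓝[>] 0) (𝓝 0)) (hf0 : Tendsto f (𝓝[>] 0) (𝓝 0))
    {a b p q : ℝ} (ha : 0 < a) (hb : 0 < b) (hpq : p ^ 2 + q ^ 2 = 1)
    (hs : 0 < Φ (p ^ 2 / a + q ^ 2 / b) / (p ^ 2 / a + q ^ 2 / b)) :
    f (Φ (p ^ 2 / a + q ^ 2 / b) / (p ^ 2 / a + q ^ 2 / b)) =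
      Φ (p ^ 2 / f a + q ^ 2 / f b) / (p ^ 2 / f a + q ^ 2 / f b) := by
  have cΦ := hΦ.2.2.continuousOn
  have hP := rankOne_posSemidef p q
  have hPP := rankOne_mul_self hpq
  have pdK : ∀ d : ℝ, 0 < d →
      (kuboMean Φ (realDiag a b) (rankOne p q + d • (1 - rankOne p q))).PosDef :=
    fun d hd => kuboMean_posDef hΦ.1 (realDiag_posDef ha hb) (rankOne_add_smul_posDef hpq hd)
  have lim1 := tendsto_matFun (continuous_extendZero hf.2.2.continuousOn hf0)
    (by filter_upwards [self_mem_nhdsWithin] with d hd using (pdK d hd).1)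
    (tendsto_kuboMean_rankOne cΦ hΦ0 ha hb hpq)
  have e1 := matFun_proj (extendZero f) hP.1 hPP
    (Φ (p ^ 2 / a + q ^ 2 / b) / (p ^ 2 / a + q ^ 2 / b)) 0
  rw [show extendZero f 0 = 0 from if_neg (lt_irrefl 0), zero_smul, add_zero,
    add_zero, extendZero_of_pos f hs] at e1
  rw [e1] at lim1
  have lf : Tendsto f (𝓝[>] 0) (𝓝[>] 0) := by
    rw [tendsto_nhdsWithin_iff]
    refine ⟨hf0, ?_⟩
    filter_upwards [self_mem_nhdsWithin] with d hd using hf.1 d hd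
  have lim2 := (tendsto_kuboMean_rankOne cΦ hΦ0 (hf.1 a ha) (hf.1 b hb) hpq).comp lf
  have lim3 := lim2.congr' (f₂ := fun d => matFun (extendZero f)
      (kuboMean Φ (realDiag a b) (rankOne p q + d • (1 - rankOne p q)))) (by
    filter_upwards [self_mem_nhdsWithin] with d hd
    have e2 := matFun_proj f hP.1 hPP 1 d
    rw [hf.2.1, one_smul] at e2
    rw [matFun_congr (fun t ht => extendZero_of_pos f ht) (pdK d hd),
      h 2 _ _ (realDiag_posDef ha hb) (rankOne_add_smul_posDef hpq hd), matFun_realDiag, e2,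
      Function.comp_apply])
  exact smul_rankOne_injective hpq (tendsto_nhds_unique lim1 lim3)

theorem PreservesMean.scalar {Φ f : ℝ → ℝ} (h : PreservesMean Φ f) (hf : OMone f) {a b : ℝ}
    (ha : 0 < a) (hb : 0 < b) : f (a * Φ (b / a)) = f a * Φ (f b / f a) := by
  have e := h 2 _ _ (realDiag_posDef ha ha) (realDiag_posDef hb hb)
  rw [kuboMean_realDiag Φ ha, matFun_realDiag, matFun_realDiag, matFun_realDiag,
    kuboMean_realDiag Φ (hf.1 a ha)] at e
  have := congrFun (congrFun e 0) 0
  simpa only [realDiag, Matrix.cons_val_zero, Matrix.of_apply, Complex.ofReal_inj] using this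

theorem PreservesMean.tendsto_zero {Φ f : ℝ → ℝ} (h : PreservesMean Φ f) (hf : OMone f)
    (hΦ : OMone Φ) (hfnt : ¬ OMTrivial f) (hΦnt : ¬ OMTrivial Φ)
    (hΦ0 : Tendsto Φ (𝓝[>] 0) (𝓝 0)) : Tendsto f (𝓝[>] 0) (𝓝 0) := by
  have hbdd : BddBelow (f '' Ioi 0) := ⟨0, by rintro _ ⟨x, hx, rfl⟩; exact (hf.1 x hx).le⟩
  have hlim := hf.2.2.monotoneOn.tendsto_nhdsGT hbdd
  set L := sInf (f '' Ioi 0)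
  have hL : 0 ≤ L := le_csInf ⟨f 1, 1, mem_Ioi.mpr one_pos, rfl⟩
    (by rintro _ ⟨x, hx, rfl⟩; exact (hf.1 x hx).le)
  rcases hL.eq_or_lt with hL | hL
  · rwa [← hL] at hlim
  have hconst : ∀ a : ℝ, 0 < a → f a = L := by
    intro a ha
    have hfa := hf.1 a ha
    have lin : Tendsto (fun x : ℝ => x / a) (𝓝[>] 0) (𝓝[>] 0) := by
      rw [tendsto_nhdsWithin_iff]
      constructor
      · have : Tendsto (fun x : ℝ => x / a) (𝓝[>] 0) (𝓝 (0 / a)) :=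
          (Continuous.tendsto (by fun_prop) _).mono_left nhdsWithin_le_nhds
        rwa [zero_div] at this
      · filter_upwards [self_mem_nhdsWithin] with x hx using div_pos hx ha
    have lhs : Tendsto (fun x : ℝ => f (a * Φ (x / a))) (𝓝[>] 0) (𝓝 L) := by
      refine hlim.comp ?_
      rw [tendsto_nhdsWithin_iff]
      constructor
      · simpa using (hΦ0.comp lin).const_mul a
      · filter_upwards [self_mem_nhdsWithin] with x hx
        exact mul_pos ha (hΦ.1 _ (div_pos hx ha))
    have rhs : Tendsto (fun x : ℝ => f a * Φ (f x / f a)) (𝓝[>] 0) (𝓝 (f a * Φ (L / f a))) :=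
      ((hΦ.2.2.continuousOn.continuousAt (Ioi_mem_nhds (div_pos hL hfa))).tendsto.comp
        (hlim.div_const (f a))).const_mul (f a)
    have e : L = f a * Φ (L / f a) := by
      refine tendsto_nhds_unique lhs (rhs.congr' ?_)
      filter_upwards [self_mem_nhdsWithin] with x hx
      exact (h.scalar hf ha hx).symm
    have hu := ratio_injective hΦ hΦnt hΦ0 (div_pos hL hfa) one_pos (by
      rw [hΦ.2.1]
      generalize Φ (L / f a) = c at e
      field_simp
      linarith)
    rw [div_eq_one_iff_eq hfa.ne'] at hu
    exact hu.symm
  refine (hfnt (Or.inl fun t ht => ?_)).elim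
  rw [hconst t ht, ← hconst 1 one_pos, hf.2.1]

theorem harmRep_of_adjFun_affine {g : ℝ → ℝ} {α : ℝ} (hpos : ∀ t, 0 < t → 0 < g t)
    (hnt : ¬ OMTrivial g) (h : ∀ x, 0 < x → adjFun g x = 1 + α * (x - 1)) :
    α ∈ Ioo (0 : ℝ) 1 ∧ ∀ t, 0 < t → g t = harmRep α t := by
  have hg : ∀ t, 0 < t → g t = harmRep α t := by
    intro t ht
    have := h t⁻¹ (inv_pos.mpr ht)
    rw [adjFun, inv_inv] at this
    rw [harmRep, ← _root_.inv_inj, this, inv_inv]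
    ring
  have hz : ¬ (α ≠ 0 ∧ 0 < 1 - α⁻¹) := by
    rintro ⟨h0, hx⟩
    have h1 := h _ hx
    have h2 : 0 < adjFun g (1 - α⁻¹) := inv_pos.mpr (hpos _ (inv_pos.mpr hx))
    rw [h1, show 1 + α * (1 - α⁻¹ - 1) = 0 by field_simp; ring] at h2
    exact lt_irrefl _ h2
  refine ⟨⟨?_, ?_⟩, hg⟩
  · rcases lt_trichotomy α 0 with hα | hα | hα
    · refine (hz ⟨hα.ne, ?_⟩).elim
      have := inv_neg''.mpr hα
      linarith
    · refine (hnt (Or.inl fun t ht => ?_)).elim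
      simp [hg t ht, harmRep, hα]
    · exact hα
  · rcases lt_trichotomy α 1 with hα | hα | hα
    · exact hα
    · refine (hnt (Or.inr fun t ht => ?_)).elim
      simp [hg t ht, harmRep, hα]
    · refine (hz ⟨by linarith, ?_⟩).elim
      have := inv_lt_one_of_one_lt₀ hα
      linarith

theorem PreservesMean.adjFun_affine {Φ f : ℝ → ℝ} (h : PreservesMean Φ f) (hf : OMone f)
    (hΦ : OMone Φ) (hfnt : ¬ OMTrivial f) (hΦnt : ¬ OMTrivial Φ)
    (hΦ0 : Tendsto Φ (𝓝[>] 0) (𝓝 0)) {x : ℝ} (hx : 0 < x) :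
    adjFun f x = 1 + (adjFun f 2 - 1) * (x - 1) := by
  have hf0 := h.tendsto_zero hf hΦ hfnt hΦnt hΦ0
  have kpos : ∀ {t}, 0 < t → 0 < adjFun f t := fun ht => inv_pos.mpr (hf.1 _ (inv_pos.mpr ht))
  have conv : ∀ {x y l : ℝ}, 0 < x → 0 < y → 0 ≤ l → l ≤ 1 →
      adjFun f (l * x + (1 - l) * y) = l * adjFun f x + (1 - l) * adjFun f y := by
    intro x y l hx hy hl hl1
    have pos : ∀ {x y : ℝ}, 0 < x → 0 < y → 0 < l * x + (1 - l) * y := by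
      intro x y hx hy
      rcases hl.eq_or_lt with rfl | hl
      · simpa using hy
      · have := mul_nonneg (sub_nonneg.mpr hl1) hy.le
        positivity
    have hs := pos hx hy
    have key := h.rankOne_eq hf hΦ hΦ0 hf0 (inv_pos.mpr hx) (inv_pos.mpr hy) (p := √l)
      (q := √(1 - l)) (by rw [Real.sq_sqrt hl, Real.sq_sqrt (sub_nonneg.mpr hl1)]; ring)
    rw [Real.sq_sqrt hl, Real.sq_sqrt (sub_nonneg.mpr hl1), div_inv_eq_mul, div_inv_eq_mul] at key
    have key1 := h.rankOne_eq hf hΦ hΦ0 hf0 (inv_pos.mpr hs) (inv_pos.mpr hs) (p := 1)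
      (q := 0) (by norm_num)
    norm_num at key1
    have hg := div_pos (hΦ.1 _ hs) hs
    refine ratio_injective hΦ hΦnt hΦ0 (kpos hs) (pos (kpos hx) (kpos hy)) ?_
    have e1 := key1 hg
    have e2 := key hg
    simp only [adjFun]
    rw [e2] at e1
    simpa only [div_eq_mul_inv, inv_inv, one_mul] using e1.symm
  have k1 : adjFun f 1 = 1 := by simp [adjFun, hf.2.1]
  rcases le_or_gt x 1 with hx1 | hx1
  · have := conv (x := x) (y := 2) (l := 1 / (2 - x)) hx two_pos
      (div_nonneg one_pos.le (by linarith)) ((div_le_one (by linarith)).mpr (by linarith))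
    have h2 : 0 < 2 - x := by linarith
    rw [show 1 / (2 - x) * x + (1 - 1 / (2 - x)) * 2 = 1 by field_simp; ring, k1] at this
    field_simp at this
    linear_combination -this
  rcases le_or_gt x 2 with hx2 | hx2
  · have := conv (x := 1) (y := 2) (l := 2 - x) one_pos two_pos (by linarith) (by linarith)
    rw [show (2 - x) * 1 + (1 - (2 - x)) * 2 = x by ring, k1] at this
    linear_combination this
  · have h2 : 0 < x - 1 := by linarith
    have := conv (x := x) (y := 1) (l := 1 / (x - 1)) hx one_pos
      (div_nonneg one_pos.le (by linarith)) ((div_le_one (by linarith)).mpr (by linarith))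
    rw [show 1 / (x - 1) * x + (1 - 1 / (x - 1)) * 1 = 2 by field_simp; ring, k1] at this
    rw [this]
    field_simp
    ring

theorem adjFun_shift {Φ f : ℝ → ℝ} (h : PreservesMean Φ f) (hf : OMone f) {β : ℝ}
    (hβ : β ∈ Ioo (0 : ℝ) 1) (hfβ : ∀ t, 0 < t → f t = harmRep β t) (hΦ : ∀ t, 0 < t → 0 < Φ t)
    {a b d : ℝ} (ha : 0 < a) (hb : 0 < b) (hd : 0 < d) :
    (a + d) * adjFun Φ ((b + d) / (a + d)) = a * adjFun Φ (b / a) + d := by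
  obtain ⟨hβ0, hβ1⟩ := hβ
  have h1β : 0 < 1 - β := by linarith
  have key : ∀ {x y : ℝ}, 0 < x → 0 < y → (1 - β) + β * (x * adjFun Φ (y / x)) =
      ((1 - β) + β * x) * adjFun Φ (((1 - β) + β * y) / ((1 - β) + β * x)) := by
    intro x y hx hy
    have e := h.scalar hf (inv_pos.mpr hx) (inv_pos.mpr hy)
    have hc := hΦ (y⁻¹ / x⁻¹) (by positivity)
    rw [hfβ _ (mul_pos (inv_pos.mpr hx) hc), hfβ _ (inv_pos.mpr hx),
      hfβ _ (inv_pos.mpr hy)] at e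
    simp only [harmRep, adjFun] at e ⊢
    rw [inv_inv, inv_inv, mul_inv, inv_inv, inv_div_inv, inv_div_inv] at e
    rw [inv_div, inv_div, ← _root_.inv_inj, e, mul_inv, inv_inv]
  have := key (x := (1 - β) / (β * d) * a) (y := (1 - β) / (β * d) * b) (by positivity)
    (by positivity)
  have e1 : ∀ z, (1 - β) + β * ((1 - β) / (β * d) * z) = (1 - β) / d * (z + d) := by
    intro z; field_simp; ring
  rw [mul_assoc ((1 - β) / (β * d)) a, e1, e1, e1,
    mul_div_mul_left _ _ (by positivity : (1 - β) / (β * d) ≠ 0),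
    mul_div_mul_left _ _ (by positivity : (1 - β) / d ≠ 0), mul_assoc] at this
  exact (mul_left_cancel₀ (by positivity : (1 - β) / d ≠ 0) this).symm

theorem adjFun_affine_of_shift {Φ : ℝ → ℝ} (hΦ : OMone Φ) (h0 : Tendsto Φ (𝓝[>] 0) (𝓝 0))
    (h : ∀ {a b d : ℝ}, 0 < a → 0 < b → 0 < d →
      (a + d) * adjFun Φ ((b + d) / (a + d)) = a * adjFun Φ (b / a) + d) :
    ∃ α, ∀ x, 0 < x → adjFun Φ x = 1 + α * (x - 1) := by
  have conc := adjFun_concaveOn hΦ.2.2 hΦ.1 h0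
  have k1 : adjFun Φ 1 = 1 := by simp [adjFun, hΦ.2.1]
  set α := adjFun Φ 2 - 1 with hα
  set α' := 2 - 2 * adjFun Φ (1 / 2) with hα'
  have cst : ∀ F : ℝ → ℝ, (∀ a d, 0 < a → 0 < d → F (a + d) = F a) → ∀ a, 0 < a → F a = F 1 := by
    intro F hF a ha
    rw [← hF a 1 ha one_pos, add_comm, hF 1 a one_pos ha]
  have up : ∀ x, 1 ≤ x → adjFun Φ x = 1 + α * (x - 1) := by
    intro x hx
    rcases hx.eq_or_lt with rfl | hx
    · simp [k1]
    have hx' : 0 < x - 1 := by linarith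
    have := cst (fun a => a * adjFun Φ ((a + 1) / a) - a) (fun a d ha hd => by
      have := h (b := a + 1) ha (by linarith) hd
      rw [add_right_comm a d 1, this]
      ring) (x - 1)⁻¹ (inv_pos.mpr hx')
    rw [show ((x - 1)⁻¹ + 1) / (x - 1)⁻¹ = x by field_simp; ring,
      show ((1 : ℝ) + 1) / 1 = 2 by norm_num] at this
    field_simp at this
    linarith
  have down : ∀ x, 0 < x → x ≤ 1 → adjFun Φ x = 1 + α' * (x - 1) := by
    intro x hx0 hx
    rcases hx.eq_or_lt with rfl | hx
    · simp [k1]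
    have hx' : 0 < 1 - x := by linarith
    have := cst (fun a => (a + 1) * adjFun Φ (a / (a + 1)) - a) (fun a d ha hd => by
      have := h (a := a + 1) (b := a) (by linarith) ha hd
      rw [add_right_comm a d 1, this]
      ring) (x / (1 - x)) (div_pos hx0 hx')
    rw [show x / (1 - x) / (x / (1 - x) + 1) = x by field_simp; ring,
      show (1 : ℝ) / (1 + 1) = 1 / 2 by norm_num] at this
    field_simp at this
    linarith
  have le1 : α ≤ α' := by
    have := conc.three_point (x := 1 / 2) (y := 1) (z := 3 / 2) (by norm_num) (by norm_num)
      (by norm_num)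
    rw [up (3 / 2) (by norm_num), up 1 le_rfl, down (1 / 2) (by norm_num) (by norm_num)] at this
    linarith
  have le2 : α' ≤ α := by
    have l1 : Tendsto (fun e : ℝ => α' * (1 - e + α * e)) (𝓝[>] 0)
        (𝓝 (α' * (1 - 0 + α * 0))) :=
      (Continuous.tendsto (by fun_prop) _).mono_left nhdsWithin_le_nhds
    have l2 : Tendsto (fun e : ℝ => α * (1 + e - α' * e)) (𝓝[>] 0)
        (𝓝 (α * (1 + 0 - α' * 0))) :=
      (Continuous.tendsto (by fun_prop) _).mono_left nhdsWithin_le_nhds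
    rw [sub_zero, mul_zero, add_zero, mul_one] at l1
    rw [add_zero, mul_zero, sub_zero, mul_one] at l2
    refine le_of_tendsto_of_tendsto l1 l2 ?_
    filter_upwards [Ioo_mem_nhdsGT one_pos] with e he
    obtain ⟨he0, he1⟩ := he
    have hm : 0 < 1 - e := by linarith
    have hp : 0 < 1 + e := by linarith
    have u := up (1 - e)⁻¹ ((one_le_inv₀ hm).mpr (by linarith))
    have v := down (1 + e)⁻¹ (inv_pos.mpr hp) (inv_le_one_of_one_le₀ (by linarith))
    rw [adjFun, inv_inv] at u v
    have t := hΦ.2.2.concaveOn.three_point (x := 1 - e) (y := 1) (z := 1 + e) hm (by linarith)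
      (by linarith)
    rw [hΦ.2.1] at t
    have hΦm := hΦ.1 _ hm
    have hΦp := hΦ.1 _ hp
    generalize Φ (1 - e) = P at *
    generalize Φ (1 + e) = Q at *
    have u' : 1 - e = P * (1 - e + α * e) := by
      field_simp at u
      linarith
    have v' : 1 + e = Q * (1 + e - α' * e) := by
      field_simp at v
      linarith
    have hu : 0 < 1 - e + α * e := by
      by_contra! hc
      linarith [mul_nonneg hΦm.le (neg_nonneg.mpr hc)]
    have hv : 0 < 1 + e - α' * e := by
      by_contra! hc
      linarith [mul_nonneg hΦp.le (neg_nonneg.mpr hc)]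
    have t' : P + Q ≤ 2 := by
      refine le_of_mul_le_mul_left ?_ he0
      linarith
    have t'' := mul_le_mul_of_nonneg_right t' (mul_pos hu hv).le
    refine le_of_mul_le_mul_left ?_ he0
    linear_combination t'' + (1 + e - α' * e) * u' + (1 - e + α * e) * v'
  exact ⟨α, fun x hx => by
    rcases le_or_gt 1 x with h | h
    · exact up x h
    · rw [down x hx h.le, le_antisymm le1 le2]⟩

theorem matFun_inv {n : ℕ} {A : Matrix (Fin n) (Fin n) ℂ} (hA : A.PosDef) (f : ℝ → ℝ)
    (hf : ∀ t, 0 < t → f t ≠ 0) : matFun (fun x => (f x)⁻¹) A = (matFun f A)⁻¹ := by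
  refine (Matrix.inv_eq_left_inv ?_).symm
  rw [matFun, matFun, ← cfc_mul _ _ A (continuousOn_spectrum _ _) (continuousOn_spectrum _ _),
    ← cfc_const_one ℝ A hA.1]
  exact cfc_congr fun x hx => inv_mul_cancel₀ (hf x (spectrum_pos_of_posDef hA hx))

theorem matFun_id {n : ℕ} {A : Matrix (Fin n) (Fin n) ℂ} (hA : A.PosDef) :
    matFun (fun x => x) A = A :=
  cfc_id' ℝ A hA.1

theorem harmRep_pos {α : ℝ} (hα : α ∈ Ioo (0 : ℝ) 1) {t : ℝ} (ht : 0 < t) :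
    0 < harmRep α t := by
  have := hα.1
  have := sub_pos.mpr hα.2
  rw [harmRep]
  positivity

theorem matFun_harmRep {n : ℕ} {α : ℝ} (hα : α ∈ Ioo (0 : ℝ) 1) {A : Matrix (Fin n) (Fin n) ℂ}
    (hA : A.PosDef) : matFun (harmRep α) A = ((1 - α) • 1 + α • A⁻¹)⁻¹ := by
  have h : matFun (harmRep α) A = (matFun (fun t => (1 - α) + α * t⁻¹) A)⁻¹ :=
    matFun_inv hA _ fun t ht => (inv_pos.mp (harmRep_pos hα ht)).ne'
  have hi := matFun_inv hA (fun x => x) fun t ht => ht.ne'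
  rw [matFun_id hA, matFun] at hi
  rw [h, matFun, cfc_const_add (1 - α) (fun x => α * x⁻¹) A (continuousOn_spectrum _ _)
      hA.1.isSelfAdjoint, cfc_const_mul α (fun x => x⁻¹) A (continuousOn_spectrum _ _), hi,
    Algebra.algebraMap_eq_smul_one]

theorem kuboMean_harmRep {n : ℕ} {α : ℝ} (hα : α ∈ Ioo (0 : ℝ) 1)
    {A B : Matrix (Fin n) (Fin n) ℂ} (hA : A.PosDef) (hB : B.PosDef) :
    kuboMean (harmRep α) A B = ((1 - α) • A⁻¹ + α • B⁻¹)⁻¹ := by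
  have hS : (matFun Real.sqrt A).PosDef := matFun_posDef (fun _ ht => Real.sqrt_pos.mpr ht) hA
  have hi := matFun_inv hA Real.sqrt fun t ht => (Real.sqrt_pos.mpr ht).ne'
  have hSS : matFun Real.sqrt A * matFun Real.sqrt A = A := by
    conv_rhs => rw [← matFun_id hA]
    rw [matFun, ← cfc_mul _ _ A (continuousOn_spectrum _ _) (continuousOn_spectrum _ _)]
    exact cfc_congr fun x hx => Real.mul_self_sqrt (spectrum_pos_of_posDef hA hx).le
  rw [kuboMean, hi]
  set S := matFun Real.sqrt A
  have hu : IsUnit S.det := (Matrix.isUnit_iff_isUnit_det S).mp hS.isUnit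
  have e : S⁻¹ * ((1 - α) • 1 + α • (S * B⁻¹ * S)) * S⁻¹ = (1 - α) • A⁻¹ + α • B⁻¹ := by
    rw [Matrix.mul_add, Matrix.add_mul, Matrix.mul_smul, Matrix.smul_mul, Matrix.mul_one,
      ← Matrix.mul_inv_rev, hSS, Matrix.mul_smul, Matrix.smul_mul, Matrix.mul_assoc S,
      Matrix.nonsing_inv_mul_cancel_left _ _ hu, Matrix.mul_assoc, Matrix.mul_nonsing_inv _ hu,
      Matrix.mul_one]
  rw [matFun_harmRep hα (mul_mul_posDef hS.inv hB), Matrix.mul_inv_rev, Matrix.mul_inv_rev,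
    Matrix.nonsing_inv_nonsing_inv _ hu, ← e, Matrix.mul_inv_rev, Matrix.mul_inv_rev,
    Matrix.nonsing_inv_nonsing_inv _ hu, ← Matrix.mul_assoc, ← Matrix.mul_assoc]

theorem preservesMean_harmRep {α β : ℝ} (hα : α ∈ Ioo (0 : ℝ) 1) (hβ : β ∈ Ioo (0 : ℝ) 1) :
    PreservesMean (harmRep α) (harmRep β) := by
  intro n A B hA hB
  have pα := fun t => harmRep_pos (t := t) hα
  have pβ := fun t => harmRep_pos (t := t) hβ
  have hβ' := sub_pos.mpr hβ.2
  have hα' := sub_pos.mpr hα.2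
  have aux : ∀ {a b : ℝ} {X Y : Matrix (Fin n) (Fin n) ℂ}, 0 < a → 0 < b → X.PosDef → Y.PosDef →
      ((a • X + b • Y)⁻¹)⁻¹ = a • X + b • Y := fun ha hb hX hY =>
    Matrix.nonsing_inv_nonsing_inv _
      ((Matrix.isUnit_iff_isUnit_det _).mp ((hX.smul ha).add (hY.smul hb)).isUnit)
  rw [matFun_harmRep hβ (kuboMean_posDef pα hA hB), kuboMean_harmRep hα hA hB,
    kuboMean_harmRep hα (matFun_posDef pβ hA) (matFun_posDef pβ hB), matFun_harmRep hβ hA,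
    matFun_harmRep hβ hB, aux hα' hα.1 hA.inv hB.inv, aux hβ' hβ.1 PosDef.one hA.inv,
    aux hβ' hβ.1 PosDef.one hB.inv]
  congr 1
  module

theorem PreservesMean.congr {Φ Φ' f f' : ℝ → ℝ} (h : PreservesMean Φ f)
    (hΦ : ∀ t, 0 < t → 0 < Φ t) (hf : ∀ t, 0 < t → 0 < f t)
    (hΦ' : ∀ t, 0 < t → Φ' t = Φ t) (hf' : ∀ t, 0 < t → f' t = f t) : PreservesMean Φ' f' := by
  have hk : ∀ {n : ℕ} {A B : Matrix (Fin n) (Fin n) ℂ}, A.PosDef → B.PosDef →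
      kuboMean Φ' A B = kuboMean Φ A B := by
    intro n A B hA hB
    rw [kuboMean, kuboMean, matFun_congr hΦ' (mul_mul_posDef
      (matFun_posDef (fun _ ht => inv_pos.mpr (Real.sqrt_pos.mpr ht)) hA) hB)]
  intro n A B hA hB
  rw [hk hA hB, matFun_congr hf' (kuboMean_posDef hΦ hA hB), matFun_congr hf' hA,
    matFun_congr hf' hB, hk (matFun_posDef hf hA) (matFun_posDef hf hB), h n A B hA hB]

theorem stmt_9 (f Φ : ℝ → ℝ) (hf : OMone f) (hΦ : OMone Φ)
    (hfnt : ¬ OMTrivial f) (hΦnt : ¬ OMTrivial Φ)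
    (hΦ0 : Filter.Tendsto Φ (nhdsWithin 0 (Set.Ioi 0)) (nhds 0)) :
    PreservesMean Φ f ↔
      ∃ α ∈ Set.Ioo (0 : ℝ) 1, ∃ β ∈ Set.Ioo (0 : ℝ) 1,
        (∀ t : ℝ, 0 < t → Φ t = harmRep α t) ∧ (∀ t : ℝ, 0 < t → f t = harmRep β t) := by
  constructor
  · intro h
    obtain ⟨hβ, hfβ⟩ := harmRep_of_adjFun_affine hf.1 hfnt
      fun x hx => h.adjFun_affine hf hΦ hfnt hΦnt hΦ0 hx
    obtain ⟨α, hα⟩ := adjFun_affine_of_shift hΦ hΦ0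
      fun ha hb hd => adjFun_shift h hf hβ hfβ hΦ.1 ha hb hd
    obtain ⟨hα', hΦα⟩ := harmRep_of_adjFun_affine hΦ.1 hΦnt hα
    exact ⟨α, hα', _, hβ, hΦα, hfβ⟩
  · rintro ⟨α, hα, β, hβ, hΦα, hfβ⟩
    exact (preservesMean_harmRep hα hβ).congr (fun _ => harmRep_pos hα) (fun _ => harmRep_pos hβ)
      hΦα hfβ
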